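/- arXiv:1011.5270 — 10 statements merged into one kernel-verified Lean document; each statement's English description precedes it below -/
import Mathlib

section
/- The Mmon-functorial clustering scheme C which assigns to each finite metric space (X,d) with at least two points the equivalence relation ∼_{1/sep(X)} is not excisive: there exists a finite metric space (X,d) and an equivalence class B of C_X such that the relation C_B on the restricted metric space (B, d|_{B×B}) does not relate all points of B to each other. -/
/-- The separation of a metric space: the infimum of distances between distinct points. -/
noncomputable def sep (X : Type*) [MetricSpace X] : ℝ :=
  sInf {r | ∃ x x' : X, x ≠ x' ∧ dist x x' = r}

/-- The clustering scheme assigning to a finite metric space `X` the chain equivalence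
relation `∼_{1/sep(X)}`. -/
def SchemeRel (X : Type*) [MetricSpace X] : X → X → Prop :=
  Relation.ReflTransGen fun a b : X => dist a b ≤ 1 / sep X

theorem sep_eq_of_attained {X : Type*} [MetricSpace X] {r : ℝ} {p q : X} (hpq : p ≠ q)
    (hr : dist p q = r) (h : ∀ x x' : X, x ≠ x' → r ≤ dist x x') : sep X = r := by
  refine IsLeast.csInf_eq ⟨⟨p, q, hpq, hr⟩, ?_⟩
  rintro _ ⟨x, x', hx, rfl⟩
  exact h x x' hx

/-- Chains with steps bounded by `1 / sep X` cannot leave a set that every such step preserves. -/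
theorem SchemeRel.mem_of_mem {X : Type*} [MetricSpace X] {S : Set X}
    (hS : ∀ a ∈ S, ∀ b, dist a b ≤ 1 / sep X → b ∈ S) {a b : X} (h : SchemeRel X a b)
    (ha : a ∈ S) : b ∈ S := by
  induction h with
  | refl => exact ha
  | tail _ hbc ih => exact hS _ ih _ hbc

/-- Two pairs of points on the line, far apart: one at distance `2`, the other at distance `1/4`. -/
def twoPairs : Set ℝ := {0, 2, 10, 41 / 4}

theorem twoPairs_cases (a : twoPairs) :
    (a : ℝ) = 0 ∨ (a : ℝ) = 2 ∨ (a : ℝ) = 10 ∨ (a : ℝ) = 41 / 4 := by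
  simpa [twoPairs] using a.2

theorem sep_twoPairs : sep twoPairs = 1 / 4 := by
  refine sep_eq_of_attained (p := ⟨10, by simp [twoPairs]⟩) (q := ⟨41 / 4, by simp [twoPairs]⟩)
    ?_ ?_ ?_
  · exact Subtype.coe_ne_coe.mp (by norm_num)
  · rw [Subtype.dist_eq, Real.dist_eq]
    norm_num [abs_of_neg]
  · intro x x' hx
    rw [Ne, Subtype.ext_iff] at hx
    rw [Subtype.dist_eq, Real.dist_eq]
    rcases twoPairs_cases x with h | h | h | h <;> rcases twoPairs_cases x' with h' | h' | h' | h' <;>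
      rw [h, h'] at hx ⊢ <;>
      first
      | exact absurd rfl hx
      | norm_num [abs_of_neg, abs_of_pos]

/-- The scheme `X ↦ ∼_{1/sep X}` is not excisive: there is a finite metric space `X`
(with at least two points) and an equivalence class `B` of the scheme on `X` such that
the scheme applied to `(B, d|_{B×B})` does not relate all points of `B`. -/
theorem stmt_5 :
    ∃ (X : Type) (_ : MetricSpace X) (_ : Finite X) (_ : Nontrivial X)
      (x0 : X) (B : Set X),
      B = {a | SchemeRel X x0 a} ∧ ∃ x x' : B, ¬ SchemeRel B x x' := by
  have h0 : (0 : ℝ) ∈ twoPairs := by simp [twoPairs]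
  have h2 : (2 : ℝ) ∈ twoPairs := by simp [twoPairs]
  have hfin : Finite twoPairs := Set.Finite.to_subtype (by simp [twoPairs])
  have hnon : Nontrivial twoPairs := ⟨⟨0, h0⟩, ⟨2, h2⟩, by rw [Ne, Subtype.mk.injEq]; norm_num⟩
  refine ⟨twoPairs, inferInstance, hfin, hnon, ⟨0, h0⟩, _, rfl, ?_⟩
  set B : Set twoPairs := {a | SchemeRel twoPairs ⟨0, h0⟩ a} with hB
  have hB0 : (⟨0, h0⟩ : twoPairs) ∈ B := Relation.ReflTransGen.refl
  have hB2 : (⟨2, h2⟩ : twoPairs) ∈ B := by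
    refine Relation.ReflTransGen.single ?_
    rw [sep_twoPairs, Subtype.dist_eq, Real.dist_eq]
    norm_num [abs_of_neg]
  have hcases (b : B) : (b : ℝ) = 0 ∨ (b : ℝ) = 2 := by
    refine SchemeRel.mem_of_mem (S := {a : twoPairs | (a : ℝ) = 0 ∨ (a : ℝ) = 2}) ?_ b.2 (.inl rfl)
    intro a ha c hac
    rw [sep_twoPairs, Subtype.dist_eq, Real.dist_eq, abs_le] at hac
    rcases ha with ha | ha <;> rcases twoPairs_cases c with h | h | h | h <;>
      first
      | exact .inl h
      | exact .inr h
      | (rw [ha, h] at hac; norm_num at hac)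
  have hsep : sep B = 2 := by
    refine sep_eq_of_attained (p := ⟨_, hB0⟩) (q := ⟨_, hB2⟩) ?_ ?_ ?_
    · rw [Ne, Subtype.mk.injEq, Subtype.mk.injEq]
      norm_num
    · rw [Subtype.dist_eq, Subtype.dist_eq, Real.dist_eq]
      norm_num
    · intro x x' hx
      rw [Ne, Subtype.ext_iff, Subtype.ext_iff] at hx
      rw [Subtype.dist_eq, Subtype.dist_eq, Real.dist_eq]
      rcases hcases x with h | h <;> rcases hcases x' with h' | h' <;>
        rw [h, h'] at hx ⊢ <;>
        first
        | exact absurd rfl hx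
        | norm_num
  refine ⟨⟨_, hB0⟩, ⟨_, hB2⟩, fun h => ?_⟩
  have h20 : (2 : ℝ) = 0 := by
    refine SchemeRel.mem_of_mem (S := {b : B | (b : ℝ) = 0}) ?_ h rfl
    intro a ha c hac
    rw [hsep, Subtype.dist_eq, Subtype.dist_eq, Real.dist_eq, abs_le] at hac
    rcases hcases c with h | h
    · exact h
    · rw [show (a : ℝ) = 0 from ha, h] at hac
      norm_num at hac
  norm_num at h20
end

section
/- Let Ω be a collection of finite metric spaces and let C^Ω be the clustering scheme represented by Ω (over injective distance non-increasing maps). Then C^Ω is excisive: for every finite metric space (X,d) and every C^Ω_X-equivalence class B ⊆ X (with the restricted metric d|_{B×B}), the relation C^Ω_B relates all points of B to each other. In particular, C^Ω(ω) consists of a single class for every ω ∈ Ω. -/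
/-- The clustering relation `C^Ω` on a metric space `X`, for a collection `Ω` of finite
metric spaces given as an indexed family `ω : A → Type`:  `x` and `x'` are related iff
they are joined by a chain `z_0, …, z_k` in which each consecutive pair lies in the image
of an injective distance non-increasing map from some member of `Ω`. -/
def RepRel {A : Type} (ω : A → Type) [∀ a, MetricSpace (ω a)]
    (X : Type) [MetricSpace X] : X → X → Prop :=
  Relation.ReflTransGen fun z z' : X =>
    ∃ (a : A) (f : ω a → X), Function.Injective f ∧
      (∀ p q : ω a, dist (f p) (f q) ≤ dist p q) ∧
      ∃ α β : ω a, f α = z ∧ f β = z'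

/-- The relation `C^Ω` is symmetric. -/
theorem RepRel.symm {A : Type} {ω : A → Type} [∀ a, MetricSpace (ω a)]
    {X : Type} [MetricSpace X] {x y : X} (h : RepRel ω X x y) : RepRel ω X y x := by
  induction h with
  | refl => exact Relation.ReflTransGen.refl
  | tail _ hstep ih =>
    obtain ⟨a, f, hf, hd, α, β, hα, hβ⟩ := hstep
    exact ih.head ⟨a, f, hf, hd, β, α, hβ, hα⟩

/-- Two points in the image of an injective distance non-increasing map from a member of `Ω`
are related. -/
theorem RepRel.of_map {A : Type} {ω : A → Type} [∀ a, MetricSpace (ω a)]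
    {X : Type} [MetricSpace X] {a : A} {f : ω a → X} (hf : Function.Injective f)
    (hd : ∀ p q, dist (f p) (f q) ≤ dist p q) (p q : ω a) : RepRel ω X (f p) (f q) :=
  Relation.ReflTransGen.single ⟨a, f, hf, hd, p, q, rfl, rfl⟩

/-- A chain starting at `x` stays within the class of `x`, so it lifts to that class. -/
theorem RepRel.restrict {A : Type} {ω : A → Type} [∀ a, MetricSpace (ω a)]
    {X : Type} [MetricSpace X] {x y : X} (h : RepRel ω X x y) :
    RepRel ω {z | RepRel ω X x z} ⟨x, Relation.ReflTransGen.refl⟩ ⟨y, h⟩ := by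
  induction h with
  | refl => exact Relation.ReflTransGen.refl
  | tail hxz hstep ih =>
    obtain ⟨a, f, hf, hd, α, β, rfl, rfl⟩ := hstep
    have hmem (q : ω a) : RepRel ω X x (f q) := hxz.trans (RepRel.of_map hf hd α q)
    exact ih.trans (RepRel.of_map (f := fun q => (⟨f q, hmem q⟩ : {z | RepRel ω X x z}))
      (fun p q hpq => hf (congrArg Subtype.val hpq)) hd α β)

/-- The representable clustering scheme `C^Ω` is excisive: for every finite metric space
`X` and every `C^Ω`-equivalence class `B ⊆ X` (with the restricted metric), the relation
`C^Ω` on `B` relates all points of `B`.  In particular `C^Ω(ω)` consists of a single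
class for every `ω ∈ Ω`. -/
theorem stmt_9 (A : Type) (ω : A → Type) [∀ a, MetricSpace (ω a)] [∀ a, Finite (ω a)] :
    (∀ (X : Type) [MetricSpace X] [Finite X] (x0 : X) (B : Set X),
      B = {a | RepRel ω X x0 a} → ∀ x x' : B, RepRel ω B x x') ∧
    (∀ (a : A) (p q : ω a), RepRel ω (ω a) p q) := by
  refine ⟨?_, fun a p q => RepRel.of_map (f := id) Function.injective_id (fun _ _ => le_rfl) p q⟩
  rintro X _ _ x0 B rfl ⟨x, hx⟩ ⟨x', hx'⟩
  exact (RepRel.restrict hx).symm.trans (RepRel.restrict hx')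
end

section
/- Let C be an Mmon-functorial clustering scheme (i.e., C assigns to every finite metric space (X,d) an equivalence relation C_X on X such that for every injective distance non-increasing map f : X → Y, x C_X x' implies f(x) C_Y f(x')) which is excisive. Then C is representable: letting Ω be the collection of all metric spaces (B, d|_{B×B}) where B ranges over the C_X-equivalence classes of all finite metric spaces (X,d), one has C = C^Ω, i.e., for every finite metric space X and all x, x' ∈ X, x C_X x' holds iff x and x' are related by C^Ω in X. -/
/-- If `C` is an Mmon-functorial clustering scheme (functorial on injective distance
non-increasing maps between finite metric spaces) which is excisive, then `C` is
representable: taking `Ω` to be the collection of all `C`-equivalence classes `B` (with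
restricted metrics) of all finite metric spaces, `C` coincides with the scheme `C^Ω`
represented by `Ω`. -/
theorem stmt_10
    (C : ∀ (X : Type) [MetricSpace X] [Finite X], X → X → Prop)
    (hEq : ∀ (X : Type) [MetricSpace X] [Finite X], Equivalence (C X))
    (hFun : ∀ (X : Type) [MetricSpace X] [Finite X] (Y : Type) [MetricSpace Y] [Finite Y]
      (f : X → Y), Function.Injective f → (∀ a b : X, dist (f a) (f b) ≤ dist a b) →
      ∀ x x' : X, C X x x' → C Y (f x) (f x'))
    (hExc : ∀ (X : Type) [MetricSpace X] [Finite X] (x0 : X)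
      (x x' : {a : X // C X x0 a}), C {a : X // C X x0 a} x x')
    (X : Type) [MetricSpace X] [Finite X] (x x' : X) :
    C X x x' ↔
      Relation.ReflTransGen (fun z z' : X =>
        ∃ (W : Type) (_ : MetricSpace W) (_ : Finite W) (w0 : W)
          (f : {b : W // C W w0 b} → X), Function.Injective f ∧
          (∀ p q : {b : W // C W w0 b}, dist (f p) (f q) ≤ dist p q) ∧
          ∃ α β : {b : W // C W w0 b}, f α = z ∧ f β = z') x x' := by
  constructor
  · intro h
    exact .single ⟨X, inferInstance, inferInstance, x, Subtype.val, Subtype.val_injective,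
      fun _ _ => le_rfl, ⟨x, (hEq X).refl x⟩, ⟨x', h⟩, rfl, rfl⟩
  · intro h
    induction h with
    | refl => exact (hEq X).refl x
    | tail _ hstep ih =>
      obtain ⟨W, _, _, w0, f, hf, hd, α, β, rfl, rfl⟩ := hstep
      exact (hEq X).trans ih (hFun _ X f hf hd α β (hExc W w0 α β))
end

section
/- Let C be an Mmon-functorial clustering scheme. Then C is excisive if and only if C is representable, i.e., there exists a collection Ω of finite metric spaces with C = C^Ω. -/
/-- An Mmon-functorial clustering scheme `C` (functorial on injective distance
non-increasing maps between finite metric spaces) is excisive if and only if it is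
representable, i.e. there exists a collection `Ω` of finite metric spaces (an indexed
family) such that `C = C^Ω`. -/
theorem stmt_11
    (C : ∀ (X : Type) [MetricSpace X] [Finite X], X → X → Prop)
    (hEq : ∀ (X : Type) [MetricSpace X] [Finite X], Equivalence (C X))
    (hFun : ∀ (X : Type) [MetricSpace X] [Finite X] (Y : Type) [MetricSpace Y] [Finite Y]
      (f : X → Y), Function.Injective f → (∀ a b : X, dist (f a) (f b) ≤ dist a b) →
      ∀ x x' : X, C X x x' → C Y (f x) (f x')) :
    (∀ (Z : Type) [MetricSpace Z] [Finite Z] (z0 : Z)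
        (z z' : {a : Z // C Z z0 a}), C {a : Z // C Z z0 a} z z') ↔
      ∃ (A : Type) (ω : A → Type) (_ : ∀ a, MetricSpace (ω a)) (_ : ∀ a, Finite (ω a)),
        ∀ (X : Type) [MetricSpace X] [Finite X] (x x' : X),
          C X x x' ↔ Relation.ReflTransGen (fun z z' : X =>
            ∃ (a : A) (f : ω a → X), Function.Injective f ∧
              (∀ p q : ω a, dist (f p) (f q) ≤ dist p q) ∧
              ∃ α β : ω a, f α = z ∧ f β = z') x x' := by
  constructor
  · intro hExc
    refine ⟨Σ n : ℕ, {m : MetricSpace (Fin n) // ∀ p q, @C (Fin n) m _ p q},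
      fun a => Fin a.1, fun a => a.2.1, fun a => inferInstance, ?_⟩
    intro X _ _ x x'
    constructor
    · intro h
      obtain ⟨n, ⟨e⟩⟩ := Finite.exists_equiv_fin {a : X // C X x a}
      let m : MetricSpace (Fin n) := MetricSpace.induced e.symm e.symm.injective inferInstance
      have hm : ∀ p q, @C (Fin n) m _ p q := by
        intro p q
        have key := hFun {a : X // C X x a} (Fin n) e e.injective
          (fun a b => by
            change dist (e.symm (e a)) (e.symm (e b)) ≤ dist a b
            simp) (e.symm p) (e.symm q) (hExc X x _ _)
        simpa using key
      refine Relation.ReflTransGen.single ⟨⟨n, m, hm⟩, fun p => (e.symm p : X),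
        Subtype.val_injective.comp e.symm.injective, fun p q => le_rfl,
        e ⟨x, (hEq X).refl x⟩, e ⟨x', h⟩, ?_, ?_⟩ <;> simp
    · intro h
      induction h with
      | refl => exact (hEq X).refl x
      | tail _ step ih =>
        obtain ⟨⟨n, m, hm⟩, f, hf, hd, α, β, rfl, rfl⟩ := step
        exact (hEq X).trans ih (@hFun (Fin n) m _ X _ _ f hf hd α β (hm α β))
  · rintro ⟨A, ω, mω, fω, hC⟩ Z _ _ z0 z z'
    have hω : ∀ (a : A) (p q : ω a), C (ω a) p q := fun a p q =>
      (hC (ω a) p q).2 (.single ⟨a, id, Function.injective_id, fun _ _ => le_rfl,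
        p, q, rfl, rfl⟩)
    have lift_chain : ∀ y, Relation.ReflTransGen (fun z z' : Z =>
        ∃ (a : A) (f : ω a → Z), Function.Injective f ∧
          (∀ p q : ω a, dist (f p) (f q) ≤ dist p q) ∧
          ∃ α β : ω a, f α = z ∧ f β = z') z.1 y →
        ∃ h : C Z z0 y, C {a : Z // C Z z0 a} z ⟨y, h⟩ := by
      intro y hy
      induction hy with
      | refl => exact ⟨z.2, (hEq _).refl z⟩
      | tail _ step ih =>
        obtain ⟨h, ih⟩ := ih
        obtain ⟨a, f, hf, hd, α, β, rfl, rfl⟩ := step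
        have hmem : ∀ p, C Z z0 (f p) := fun p =>
          (hEq Z).trans h (hFun (ω a) Z f hf hd α p (hω a α p))
        exact ⟨hmem β, (hEq _).trans ih (hFun (ω a) {a : Z // C Z z0 a}
          (fun p => ⟨f p, hmem p⟩) (fun p q hpq => hf (congrArg Subtype.val hpq))
          hd α β (hω a α β))⟩
    exact (lift_chain z'.1 ((hC Z _ _).1 ((hEq Z).trans ((hEq Z).symm z.2) z'.2))).2
end

section
/- Let C be an Mmon-functorial clustering scheme which is finitely representable, say C = C^Ω for a finite collection Ω of finite metric spaces. For a finite metric space (X,d) define W_X^Ω : X × X → [0,∞] by W_X^Ω(x,x) = 0 and, for x ≠ x', W_X^Ω(x,x') = inf{λ > 0 : there exist ω ∈ Ω and an injective distance non-increasing map φ : (ω, λ·d_ω) → (X,d) with x, x' ∈ im(φ)} (inf ∅ = +∞). Then for all x, x' ∈ X: x C_X x' holds if and only if there exist points z_0, z_1, …, z_N ∈ X with z_0 = x, z_N = x' and W_X^Ω(z_i, z_{i+1}) ≤ 1 for all i. Equivalently, C equals the Vietoris–Rips scheme at scale 1 applied to (X, U(W_X^Ω)), where U(W) is the maximal subdominant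 ultrametric U(W)(x,x') = min over chains x = x_0, …, x_k = x' of max_i W(x_i, x_{i+1}). -/
open scoped ENNReal

/-- If the infimal scale at which some member of a finite family of finite metric spaces maps
injectively onto a set containing `z, z'` is at most `1`, then some member does so at scale `1`. -/
lemma exists_dist_le_of_sInf_le_one {A : Type} [Finite A] {ω : A → Type}
    [∀ a, MetricSpace (ω a)] [∀ a, Finite (ω a)] {X : Type} [MetricSpace X] [Finite X]
    {z z' : X}
    (h : sInf {e : ℝ≥0∞ | ∃ lam : ℝ, 0 < lam ∧ e = ENNReal.ofReal lam ∧
      ∃ (a : A) (f : ω a → X), Function.Injective f ∧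
        (∀ p q : ω a, dist (f p) (f q) ≤ lam * dist p q) ∧
        z ∈ Set.range f ∧ z' ∈ Set.range f} ≤ 1) :
    ∃ (a : A) (f : ω a → X), Function.Injective f ∧
      (∀ p q : ω a, dist (f p) (f q) ≤ dist p q) ∧
      z ∈ Set.range f ∧ z' ∈ Set.range f := by
  by_contra hcon
  have key : ∀ i : Σ a, (ω a → X), ∀ᶠ l : ℝ in nhdsWithin 1 (Set.Ioi 1),
      Function.Injective i.2 → z ∈ Set.range i.2 → z' ∈ Set.range i.2 →
        ∃ p q, l * dist p q < dist (i.2 p) (i.2 q) := by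
    rintro ⟨a, f⟩
    by_cases hf : Function.Injective f ∧ z ∈ Set.range f ∧ z' ∈ Set.range f
    · have hpq : ∃ p q, dist p q < dist (f p) (f q) := by
        by_contra! hle
        exact hcon ⟨a, f, hf.1, hle, hf.2⟩
      obtain ⟨p, q, hpq⟩ := hpq
      have hev : ∀ᶠ l : ℝ in nhds 1, l * dist p q < dist (f p) (f q) :=
        (by fun_prop : Continuous fun l : ℝ => l * dist p q).continuousAt.eventually_lt
          continuousAt_const (by simpa using hpq)
      filter_upwards [hev.filter_mono nhdsWithin_le_nhds] with l hl _ _ _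
      exact ⟨p, q, hl⟩
    · exact Filter.Eventually.of_forall fun l h₁ h₂ h₃ => absurd ⟨h₁, h₂, h₃⟩ hf
  obtain ⟨l, hl, hl1⟩ := ((Filter.eventually_all.2 key).and self_mem_nhdsWithin).exists
  have hlt : (1 : ℝ≥0∞) < ENNReal.ofReal l := by
    simpa using hl1
  obtain ⟨_, ⟨l', _, rfl, a, f, hf, hle, hz, hz'⟩, hl'⟩ := sInf_lt_iff.1 (h.trans_lt hlt)
  obtain ⟨p, q, hpq⟩ := hl ⟨a, f⟩ hf hz hz'
  have hll : l' ≤ l := (ENNReal.ofReal_lt_ofReal_iff_of_nonneg (by linarith)).1 hl' |>.le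
  have := mul_le_mul_of_nonneg_right hll (dist_nonneg (x := p) (y := q))
  exact absurd (hle p q) (by dsimp only at hpq; linarith)

/-- Factorization theorem for finitely representable schemes.  Let `C` be an
Mmon-functorial clustering scheme which is finitely representable, `C = C^Ω` for a finite
collection `Ω` (a family indexed by a finite type `A`).  For a finite metric space `X`
define `W_X^Ω(x,x') = inf {λ > 0 : ∃ ω ∈ Ω and an injective distance non-increasing map
(ω, λ·d_ω) → X with x, x' in its image}` (`inf ∅ = +∞`, and `W_X^Ω = 0` on the diagonal).
Then `x C_X x'` iff there is a chain `z_0 = x, …, z_N = x'` with `W_X^Ω(z_i, z_{i+1}) ≤ 1`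
for all `i`; i.e. `C` is the Vietoris–Rips scheme at scale `1` applied to the metric
obtained from `W_X^Ω`. -/
theorem stmt_12
    (C : ∀ (X : Type) [MetricSpace X] [Finite X], X → X → Prop)
    (hEq : ∀ (X : Type) [MetricSpace X] [Finite X], Equivalence (C X))
    (hFun : ∀ (X : Type) [MetricSpace X] [Finite X] (Y : Type) [MetricSpace Y] [Finite Y]
      (f : X → Y), Function.Injective f → (∀ a b : X, dist (f a) (f b) ≤ dist a b) →
      ∀ x x' : X, C X x x' → C Y (f x) (f x'))
    (A : Type) [Finite A] (ω : A → Type) [∀ a, MetricSpace (ω a)] [∀ a, Finite (ω a)]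
    (hRep : ∀ (X : Type) [MetricSpace X] [Finite X] (x x' : X),
      C X x x' ↔ Relation.ReflTransGen (fun z z' : X =>
        ∃ (a : A) (f : ω a → X), Function.Injective f ∧
          (∀ p q : ω a, dist (f p) (f q) ≤ dist p q) ∧
          ∃ α β : ω a, f α = z ∧ f β = z') x x')
    (X : Type) [MetricSpace X] [Finite X] (x x' : X) :
    C X x x' ↔
      Relation.ReflTransGen (fun z z' : X =>
        z = z' ∨
        sInf {e : ℝ≥0∞ | ∃ lam : ℝ, 0 < lam ∧ e = ENNReal.ofReal lam ∧
          ∃ (a : A) (f : ω a → X), Function.Injective f ∧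
            (∀ p q : ω a, dist (f p) (f q) ≤ lam * dist p q) ∧
            z ∈ Set.range f ∧ z' ∈ Set.range f} ≤ 1) x x' := by
  rw [hRep]
  constructor
  · refine Relation.ReflTransGen.mono ?_ x x'
    rintro z z' ⟨a, f, hf, hle, α, β, hα, hβ⟩
    exact Or.inr (sInf_le ⟨1, one_pos, by simp, a, f, hf, by simpa using hle, ⟨α, hα⟩, ⟨β, hβ⟩⟩)
  · intro h
    induction h with
    | refl => exact .refl
    | tail _ hstep ih =>
      rcases hstep with rfl | hW
      · exact ih
      · obtain ⟨a, f, hf, hle, ⟨α, hα⟩, ⟨β, hβ⟩⟩ := exists_dist_le_of_sInf_le_one hW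
        exact ih.tail ⟨a, f, hf, hle, α, β, hα, hβ⟩
end

section
/- Let C be an Mgen-functorial clustering scheme and suppose there exists δ_C > 0 such that for every δ with 0 < δ ≤ δ_C, the two points of Δ_2(δ) lie in the same C-class, while for every δ > δ_C they lie in different C-classes. Then C is the Vietoris–Rips scheme at scale δ_C: for every finite metric space (X,d) and all x, x' ∈ X, x C_X x' holds if and only if x ∼_{δ_C} x'. -/
/-- The chain equivalence relation `∼_δ` on a metric space. -/
def Sim {X : Type*} [PseudoMetricSpace X] (δ : ℝ) : X → X → Prop :=
  Relation.ReflTransGen fun a b => dist a b ≤ δ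

/-- In a finite space, the distances exceeding `δ` are bounded below by some `ε > δ`. -/
theorem exists_gt_forall_le_dist {X : Type*} [PseudoMetricSpace X] [Finite X] (δ : ℝ) :
    ∃ ε, δ < ε ∧ ∀ a b : X, δ < dist a b → ε ≤ dist a b := by
  by_cases hne : {p : X × X | δ < dist p.1 p.2}.Nonempty
  · obtain ⟨p, hp, hmin⟩ := Set.exists_min_image _ (fun p : X × X => dist p.1 p.2)
      (Set.toFinite _) hne
    exact ⟨dist p.1 p.2, hp, fun a b hab => hmin (a, b) hab⟩
  · exact ⟨δ + 1, by linarith, fun a b hab => (hne ⟨(a, b), hab⟩).elim⟩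

/-- Uniqueness theorem in `Mgen`.  Let `C` be a clustering scheme, functorial on all
distance non-increasing maps between finite metric spaces, and suppose there is a
`δ_C > 0` such that the two points of the two-point space `Δ_2(δ)` are `C`-related for
`0 < δ ≤ δ_C` and not `C`-related for `δ > δ_C`.  Then `C` is the Vietoris–Rips scheme at
scale `δ_C`: `x C_X x'` iff `x ∼_{δ_C} x'`. -/
theorem stmt_13
    (C : ∀ (X : Type) [MetricSpace X] [Finite X], X → X → Prop)
    (hEq : ∀ (X : Type) [MetricSpace X] [Finite X], Equivalence (C X))
    (hFun : ∀ (X : Type) [MetricSpace X] [Finite X] (Y : Type) [MetricSpace Y] [Finite Y]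
      (f : X → Y), (∀ a b : X, dist (f a) (f b) ≤ dist a b) →
      ∀ x x' : X, C X x x' → C Y (f x) (f x'))
    (δC : ℝ) (hδC : 0 < δC)
    (hone : ∀ δ : ℝ, 0 < δ → δ ≤ δC →
      ∀ (D : Type) [MetricSpace D] [Finite D] (p q : D),
        (∀ z : D, z = p ∨ z = q) → dist p q = δ → C D p q)
    (htwo : ∀ δ : ℝ, δC < δ →
      ∀ (D : Type) [MetricSpace D] [Finite D] (p q : D),
        (∀ z : D, z = p ∨ z = q) → dist p q = δ → ¬ C D p q)
    (X : Type) [MetricSpace X] [Finite X] (x x' : X) :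
    C X x x' ↔ Sim δC x x' := by
  constructor
  · intro h
    by_contra hx
    obtain ⟨ε, hε, hsep⟩ := exists_gt_forall_le_dist (X := X) δC
    have hε0 : 0 < ε := hδC.trans hε
    have hcross : ∀ a b : X, Sim δC x a → ¬ Sim δC x b → ε ≤ dist a b := fun a b ha hb =>
      hsep a b (lt_of_not_ge fun hab => hb (Relation.ReflTransGen.tail ha hab))
    classical
    let D : Type := ({0, ε} : Set ℝ)
    let p : D := ⟨0, Or.inl rfl⟩
    let q : D := ⟨ε, Or.inr rfl⟩
    have hpq : dist p q = ε := by
      change dist (0 : ℝ) ε = ε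
      simp [abs_of_pos hε0]
    have hD : ∀ z : D, z = p ∨ z = q := fun ⟨z, hz⟩ =>
      hz.imp (fun h => Subtype.ext h) (fun h => Subtype.ext h)
    have hC := hFun X D (fun z => if Sim δC x z then p else q) (fun a b => by
      by_cases ha : Sim δC x a <;> by_cases hb : Sim δC x b
      · simp [ha, hb]
      · simpa [ha, hb, hpq] using hcross a b ha hb
      · simpa [ha, hb, dist_comm q p, hpq, dist_comm a b] using hcross b a hb ha
      · simp [ha, hb]) x x' h
    have hxx : Sim δC x x := Relation.ReflTransGen.refl
    simp only [hxx, hx, if_true, if_false] at hC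
    exact htwo ε hε D p q hD hpq hC
  · intro h
    induction h with
    | refl => exact (hEq X).refl x
    | @tail a b _ hab ih =>
      refine (hEq X).trans ih ?_
      rcases eq_or_ne a b with rfl | hne
      · exact (hEq X).refl a
      · exact hFun ({a, b} : Set X) X Subtype.val (fun _ _ => le_rfl)
          ⟨a, Or.inl rfl⟩ ⟨b, Or.inr rfl⟩
          (hone (dist a b) (dist_pos.2 hne) hab _ _ _
            (fun ⟨z, hz⟩ => hz.imp (fun h => Subtype.ext h) (fun h => Subtype.ext h)) rfl)
end

section
/- Let C be an Mgen-functorial clustering scheme and suppose there exists δ_C > 0 such that for every δ with 0 < δ < δ_C, the two points of Δ_2(δ) lie in the same C-class, while for every δ ≥ δ_C they lie in different C-classes. Then C is the strict Vietoris–Rips scheme at scale δ_C: for every finite metric space (X,d) and all x, x' ∈ X, x C_X x' holds if and only if there exist points x_0, x_1, …, x_k ∈ X with x_0 = x, x_k = x' and d(x_i, x_{i+1}) < δ_C for all i. -/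
/-- Uniqueness theorem in `Mgen`, strict variant.  Let `C` be a clustering scheme,
functorial on all distance non-increasing maps between finite metric spaces, and suppose
there is a `δ_C > 0` such that the two points of the two-point space `Δ_2(δ)` are
`C`-related for `0 < δ < δ_C` and not `C`-related for `δ ≥ δ_C`.  Then `C` is the strict
Vietoris–Rips scheme at scale `δ_C`: `x C_X x'` iff there is a chain from `x` to `x'`
with consecutive distances `< δ_C`. -/
theorem stmt_14
    (C : ∀ (X : Type) [MetricSpace X] [Finite X], X → X → Prop)
    (hEq : ∀ (X : Type) [MetricSpace X] [Finite X], Equivalence (C X))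
    (hFun : ∀ (X : Type) [MetricSpace X] [Finite X] (Y : Type) [MetricSpace Y] [Finite Y]
      (f : X → Y), (∀ a b : X, dist (f a) (f b) ≤ dist a b) →
      ∀ x x' : X, C X x x' → C Y (f x) (f x'))
    (δC : ℝ) (hδC : 0 < δC)
    (hone : ∀ δ : ℝ, 0 < δ → δ < δC →
      ∀ (D : Type) [MetricSpace D] [Finite D] (p q : D),
        (∀ z : D, z = p ∨ z = q) → dist p q = δ → C D p q)
    (htwo : ∀ δ : ℝ, δC ≤ δ →
      ∀ (D : Type) [MetricSpace D] [Finite D] (p q : D),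
        (∀ z : D, z = p ∨ z = q) → dist p q = δ → ¬ C D p q)
    (X : Type) [MetricSpace X] [Finite X] (x x' : X) :
    C X x x' ↔ Relation.ReflTransGen (fun a b : X => dist a b < δC) x x' := by
  classical
  constructor
  · intro h
    by_contra hn
    let D : Set ℝ := {0, δC}
    have : Finite D := (Set.toFinite ({0, δC} : Set ℝ)).to_subtype
    let p : D := ⟨0, Or.inl rfl⟩
    let q : D := ⟨δC, Or.inr rfl⟩
    have hpq : dist p q = δC := by
      change dist (0 : ℝ) δC = δC
      rw [Real.dist_eq, zero_sub, abs_neg, abs_of_pos hδC]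
    let R : X → Prop := Relation.ReflTransGen (fun a b : X => dist a b < δC) x
    have far : ∀ a b : X, R a → ¬ R b → δC ≤ dist a b := fun a b ha hb =>
      not_lt.mp fun hab => hb (Relation.ReflTransGen.tail ha hab)
    have hf : ∀ a b : X, dist (if R a then p else q) (if R b then p else q) ≤ dist a b := by
      intro a b
      by_cases ha : R a <;> by_cases hb : R b <;> simp only [ha, hb, if_true, if_false]
      · simp
      · exact hpq.trans_le (far a b ha hb)
      · rw [dist_comm q p, dist_comm a b]
        exact hpq.trans_le (far b a hb ha)
      · simp
    have hC := hFun X D (fun a => if R a then p else q) hf x x' h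
    have hx : R x := Relation.ReflTransGen.refl
    have hx' : ¬ R x' := hn
    simp only [hx, hx', if_true, if_false] at hC
    refine htwo δC le_rfl D p q ?_ hpq hC
    rintro ⟨z, hz | hz⟩
    · exact Or.inl (Subtype.ext hz)
    · exact Or.inr (Subtype.ext hz)
  · intro h
    induction h with
    | refl => exact (hEq X).refl x
    | @tail a b _ hab ih =>
      refine (hEq X).trans ih ?_
      by_cases hne : a = b
      · subst hne
        exact (hEq X).refl a
      · let D : Set X := {a, b}
        let p : D := ⟨a, Or.inl rfl⟩
        let q : D := ⟨b, Or.inr rfl⟩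
        refine hFun D X Subtype.val (fun _ _ => le_rfl) p q ?_
        refine hone (dist a b) (dist_pos.mpr hne) hab D p q ?_ rfl
        rintro ⟨z, hz | hz⟩
        · exact Or.inl (Subtype.ext hz)
        · exact Or.inr (Subtype.ext hz)
end

section
/- Let C be an Mgen-functorial clustering scheme which is scale invariant, i.e., for every finite metric space (X,d) and every λ > 0, the relation assigned to (X, λ·d) equals the relation assigned to (X,d). Then either C assigns to every finite metric space the partition into singletons (C_X is the equality relation for all X), or C assigns to every finite metric space the one-block partition (C_X relates all pairs of points for all X). -/
/-- The distance function of an explicitly given metric-space structure. -/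
noncomputable def mdist {X : Type} (m : MetricSpace X) (x y : X) : ℝ :=
  @dist X m.toPseudoMetricSpace.toDist x y

/-- The metric space structure whose distance is `c` times the distance of `m`. -/
@[reducible]
noncomputable def scaledMetricSpace {X : Type} (m : MetricSpace X) (c : ℝ) (hc : 0 < c) :
    MetricSpace X where
  dist x y := c * mdist m x y
  dist_self x := by simp [mdist]
  dist_comm x y := by simp [mdist, dist_comm]
  dist_triangle x y z := by
    rw [← mul_add]
    exact mul_le_mul_of_nonneg_left (dist_triangle x y z) hc.le
  eq_of_dist_eq_zero {x y} h := by
    have h' : c * dist x y = 0 := h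
    exact dist_eq_zero.mp ((mul_eq_zero.mp h').resolve_left hc.ne')

/-- In a finite metric space, some positive multiple of the metric makes all nonzero
distances at least `D`. -/
theorem exists_pos_forall_le_mul_dist (X : Type) [MetricSpace X] [Finite X] (D : ℝ) :
    ∃ c : ℝ, 0 < c ∧ ∀ a b : X, a ≠ b → D ≤ c * dist a b := by
  obtain ⟨M, hM⟩ := (Set.finite_range fun p : X × X => D / dist p.1 p.2).bddAbove
  refine ⟨max M 1, by positivity, fun a b hab => ?_⟩
  rw [← div_le_iff₀ (dist_pos.mpr hab)]
  exact (hM ⟨(a, b), rfl⟩).trans (le_max_left M 1)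

/-- Scale-invariant `Mgen`-functorial schemes are trivial.  Let `C` be a clustering
scheme, functorial on all distance non-increasing maps between finite metric spaces,
which is scale invariant: for every finite set `X`, any two metric structures `m`, `m'`
on `X` with `m' = λ·m` (`λ > 0`) give the same relation.  Then either `C` assigns to
every finite metric space the partition into singletons, or `C` assigns to every finite
metric space the one-block partition. -/
theorem stmt_15
    (C : ∀ (X : Type) [MetricSpace X] [Finite X], X → X → Prop)
    (hEq : ∀ (X : Type) [MetricSpace X] [Finite X], Equivalence (C X))
    (hFun : ∀ (X : Type) [MetricSpace X] [Finite X] (Y : Type) [MetricSpace Y] [Finite Y]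
      (f : X → Y), (∀ a b : X, dist (f a) (f b) ≤ dist a b) →
      ∀ x x' : X, C X x x' → C Y (f x) (f x'))
    (hScale : ∀ (X : Type) [Finite X] (m m' : MetricSpace X) (lam : ℝ), 0 < lam →
      (∀ x y : X, mdist m' x y = lam * mdist m x y) →
      ∀ x x' : X, @C X m' inferInstance x x' ↔ @C X m inferInstance x x') :
    (∀ (X : Type) [MetricSpace X] [Finite X] (x x' : X), C X x x' ↔ x = x') ∨
    (∀ (X : Type) [MetricSpace X] [Finite X] (x x' : X), C X x x') := by
  classical
  refine or_iff_not_imp_left.mpr fun hne Y _ _ y y' => ?_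
  obtain ⟨X, mX, hfin, x, x', hC, hxx'⟩ :
      ∃ (X : Type) (_ : MetricSpace X) (_ : Finite X) (x x' : X), C X x x' ∧ x ≠ x' := by
    by_contra! h
    exact hne fun X _ _ x x' => ⟨h X _ _ x x', fun hx => hx ▸ (hEq X).refl x⟩
  obtain ⟨c, hc, hD⟩ := exists_pos_forall_le_mul_dist X (dist y y')
  have hscaled := (hScale X mX (scaledMetricSpace mX c hc) c hc (fun _ _ => rfl) x x').mpr hC
  have hmap := @hFun X (scaledMetricSpace mX c hc) hfin Y _ _
    (fun a => if a = x then y else y') (fun a b => ?_) x x' hscaled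
  · simpa [hxx'.symm] using hmap
  · change _ ≤ c * dist a b
    have hnonneg : 0 ≤ c * dist a b := by positivity
    by_cases ha : a = x <;> by_cases hb : b = x
    · simp [ha, hb]
    · simpa [ha, hb] using hD x b (Ne.symm hb)
    · simpa [ha, hb, dist_comm y' y] using hD a x ha
    · simpa [ha, hb] using hnonneg
end

section
/- Let C be an Mmon-functorial clustering scheme which is scale invariant, i.e., for every finite metric space (X,d) and every λ > 0, the relation assigned to (X, λ·d) equals the relation assigned to (X,d). Let K(C) = {k ≥ 2 : the relation C on Δ_k(1) relates all pairs of points}. Then: (i) if K(C) = ∅, C assigns to every finite metric space with at least two points the partition into singletons; (ii) otherwise, setting k_C = min K(C), C assigns the one-block partition to every finite metric space X with |X| ≥ k_C, and the partition into singletons to every finite metric space X with 2 ≤ |X| < k_C. -/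
/-- `k ∈ K(C)`: the scheme `C` relates all pairs of points of `Δ_k(1)`, the `k`-point
metric space with all pairwise distances `1`. -/
def OneBlockAt (C : ∀ (X : Type) [MetricSpace X] [Finite X], X → X → Prop) (k : ℕ) :
    Prop :=
  ∀ (D : Type) [MetricSpace D] [Finite D], Nat.card D = k →
    (∀ p q : D, p ≠ q → dist p q = 1) → ∀ p q : D, C D p q

/-- The metric space `(X, lam · d)`. -/
noncomputable abbrev scaledMetric {X : Type} (m : MetricSpace X) (lam : ℝ) (hlam : 0 < lam) :
    MetricSpace X where
  dist x y := lam * dist x y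
  dist_self x := by simp
  dist_comm x y := by simp [dist_comm]
  dist_triangle x y z := by
    rw [← mul_add]
    exact mul_le_mul_of_nonneg_left (dist_triangle x y z) hlam.le
  eq_of_dist_eq_zero {x y} h := by
    rcases mul_eq_zero.mp h with h | h
    · exact absurd h hlam.ne'
    · exact dist_eq_zero.mp h

open Classical in
/-- The metric on `X` with all distances between distinct points equal to `1`. -/
noncomputable abbrev unitMetric (X : Type) : MetricSpace X where
  dist x y := if x = y then 0 else 1
  dist_self x := by simp
  dist_comm x y := by simp [eq_comm]
  dist_triangle x y z := by
    by_cases hxy : x = y <;> by_cases hyz : y = z <;> by_cases hxz : x = z <;> simp_all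
  eq_of_dist_eq_zero {x y} h := by
    by_contra hne
    simp [hne] at h

theorem exists_equiv_apply_eq_apply_eq {X D : Type} [Finite X] [Finite D]
    (hcard : Nat.card X = Nat.card D) {x x' : X} (hx : x ≠ x') {p q : D} (hp : p ≠ q) :
    ∃ e : X ≃ D, e x = p ∧ e x' = q := by
  classical
  obtain ⟨e⟩ := Finite.card_eq.mp hcard
  let e₁ := e.trans (Equiv.swap (e x) p)
  have h₁ : e₁ x = p := by simp [e₁]
  have h₂ : p ≠ e₁ x' := fun h => hx (e₁.injective (h₁.trans h))
  exact ⟨e₁.trans (Equiv.swap (e₁ x') q), by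
    rw [Equiv.trans_apply, h₁, Equiv.swap_apply_of_ne_of_ne h₂ hp], by simp⟩

theorem exists_pos_one_le_mul_dist (X : Type) [MetricSpace X] [Finite X] :
    ∃ lam : ℝ, 0 < lam ∧ ∀ x y : X, x ≠ y → 1 ≤ lam * dist x y := by
  obtain ⟨B, hB⟩ := (Set.finite_range fun z : X × X => (dist z.1 z.2)⁻¹).bddAbove
  refine ⟨max B 1, by positivity, fun x y hxy => ?_⟩
  rw [← inv_le_iff_one_le_mul₀ (dist_pos.mpr hxy)]
  exact (hB ⟨(x, y), rfl⟩).trans (le_max_left _ _)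

theorem exists_pos_mul_dist_le_one (X : Type) [MetricSpace X] [Finite X] :
    ∃ lam : ℝ, 0 < lam ∧ ∀ x y : X, lam * dist x y ≤ 1 := by
  obtain ⟨B, hB⟩ := (Set.finite_range fun z : X × X => dist z.1 z.2).bddAbove
  refine ⟨(max B 1)⁻¹, by positivity, fun x y => ?_⟩
  rw [inv_mul_le_iff₀ (by positivity), mul_one]
  exact (hB ⟨(x, y), rfl⟩).trans (le_max_left _ _)

theorem oneBlockAt_card_of_related
    {C : ∀ (X : Type) [MetricSpace X] [Finite X], X → X → Prop}
    (hEq : ∀ (X : Type) [MetricSpace X] [Finite X], Equivalence (C X))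
    (hFun : ∀ (X : Type) [MetricSpace X] [Finite X] (Y : Type) [MetricSpace Y] [Finite Y]
      (f : X → Y), Function.Injective f → (∀ a b : X, dist (f a) (f b) ≤ dist a b) →
      ∀ x x' : X, C X x x' → C Y (f x) (f x'))
    (hScale : ∀ (X : Type) [Finite X] (m m' : MetricSpace X) (lam : ℝ), 0 < lam →
      (∀ x y : X, mdist m' x y = lam * mdist m x y) →
      ∀ x x' : X, @C X m' inferInstance x x' ↔ @C X m inferInstance x x')
    (X : Type) [m : MetricSpace X] [Finite X] {x x' : X}
    (h : C X x x') (hne : x ≠ x') : OneBlockAt C (Nat.card X) := by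
  intro D _ _ hcard hdist p q
  rcases eq_or_ne p q with rfl | hpq
  · exact (hEq D).refl p
  obtain ⟨lam, hlam, hle⟩ := exists_pos_one_le_mul_dist X
  obtain ⟨e, rfl, rfl⟩ := exists_equiv_apply_eq_apply_eq hcard.symm hne hpq
  refine @hFun X (scaledMetric m lam hlam) _ D _ _ e e.injective (fun a b => ?_) x x'
    ((hScale X m (scaledMetric m lam hlam) lam hlam (fun _ _ => rfl) x x').mpr h)
  rcases eq_or_ne a b with rfl | hab
  · rw [dist_self, @dist_self X (scaledMetric m lam hlam).toPseudoMetricSpace]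
  · rw [hdist _ _ (e.injective.ne hab)]
    exact hle a b hab

theorem related_of_oneBlockAt
    {C : ∀ (X : Type) [MetricSpace X] [Finite X], X → X → Prop}
    (hFun : ∀ (X : Type) [MetricSpace X] [Finite X] (Y : Type) [MetricSpace Y] [Finite Y]
      (f : X → Y), Function.Injective f → (∀ a b : X, dist (f a) (f b) ≤ dist a b) →
      ∀ x x' : X, C X x x' → C Y (f x) (f x'))
    (hScale : ∀ (X : Type) [Finite X] (m m' : MetricSpace X) (lam : ℝ), 0 < lam →
      (∀ x y : X, mdist m' x y = lam * mdist m x y) →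
      ∀ x x' : X, @C X m' inferInstance x x' ↔ @C X m inferInstance x x')
    {k : ℕ} (hk : 2 ≤ k) (hC : OneBlockAt C k) (X : Type)
    [m : MetricSpace X] [Finite X] (hX : k ≤ Nat.card X) (x x' : X) : C X x x' := by
  classical
  obtain ⟨lam, hlam, hle⟩ := exists_pos_mul_dist_le_one X
  have := Fintype.ofFinite X
  obtain ⟨S, hS, -, hcard⟩ := Finset.exists_subsuperset_card_eq
    (Finset.subset_univ {x, x'}) (Finset.card_le_two.trans hk)
    (by rwa [Finset.card_univ, ← Nat.card_eq_fintype_card])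
  refine (hScale X m (scaledMetric m lam hlam) lam hlam (fun _ _ => rfl) x x').mp ?_
  refine @hFun S (unitMetric S) _ X (scaledMetric m lam hlam) _ Subtype.val
    Subtype.val_injective (fun a b => ?_) ⟨x, hS (by simp)⟩ ⟨x', hS (by simp)⟩
    (@hC S (unitMetric S) _ (by simpa using hcard) (fun _ _ hne => if_neg hne) _ _)
  rcases eq_or_ne a b with rfl | hab
  · rw [@dist_self S (unitMetric S).toPseudoMetricSpace,
      @dist_self X (scaledMetric m lam hlam).toPseudoMetricSpace]
  · exact (hle a b).trans_eq (if_neg hab).symm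

/-- Scale-invariant `Mmon`-functorial schemes.  Let `C` be a clustering scheme functorial
on injective distance non-increasing maps which is scale invariant, and let
`K(C) = {k ≥ 2 : C relates all pairs of Δ_k(1)}`.  (i) If `K(C) = ∅` then `C` gives the
partition into singletons on every finite metric space with at least two points.
(ii) Otherwise, if `k_C = min K(C)`, then `C` gives the one-block partition on every
finite metric space with `|X| ≥ k_C`, and the partition into singletons on every finite
metric space with `2 ≤ |X| < k_C`. -/
theorem stmt_16
    (C : ∀ (X : Type) [MetricSpace X] [Finite X], X → X → Prop)
    (hEq : ∀ (X : Type) [MetricSpace X] [Finite X], Equivalence (C X))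
    (hFun : ∀ (X : Type) [MetricSpace X] [Finite X] (Y : Type) [MetricSpace Y] [Finite Y]
      (f : X → Y), Function.Injective f → (∀ a b : X, dist (f a) (f b) ≤ dist a b) →
      ∀ x x' : X, C X x x' → C Y (f x) (f x'))
    (hScale : ∀ (X : Type) [Finite X] (m m' : MetricSpace X) (lam : ℝ), 0 < lam →
      (∀ x y : X, mdist m' x y = lam * mdist m x y) →
      ∀ x x' : X, @C X m' inferInstance x x' ↔ @C X m inferInstance x x') :
    ((∀ k : ℕ, 2 ≤ k → ¬ OneBlockAt C k) →
      ∀ (X : Type) [MetricSpace X] [Finite X], 2 ≤ Nat.card X →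
        ∀ x x' : X, C X x x' → x = x') ∧
    (∀ kC : ℕ, 2 ≤ kC → OneBlockAt C kC →
      (∀ k : ℕ, 2 ≤ k → k < kC → ¬ OneBlockAt C k) →
      (∀ (X : Type) [MetricSpace X] [Finite X], kC ≤ Nat.card X →
        ∀ x x' : X, C X x x') ∧
      (∀ (X : Type) [MetricSpace X] [Finite X], 2 ≤ Nat.card X → Nat.card X < kC →
        ∀ x x' : X, C X x x' → x = x')) := by
  refine ⟨fun hK X _ _ hX x x' h => ?_, fun kC hkC hC hmin => ⟨fun X _ _ hX x x' =>
    related_of_oneBlockAt hFun hScale hkC hC X hX x x', fun X _ _ hX hlt x x' h => ?_⟩⟩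
  · by_contra hne
    exact hK _ hX (oneBlockAt_card_of_related hEq hFun hScale X h hne)
  · by_contra hne
    exact hmin _ hX hlt (oneBlockAt_card_of_related hEq hFun hScale X h hne)
end

section
/- Let (X, θ_X) be a persistent set such that θ_X(t) is the one-block partition for some t ≥ 0. Define d : X × X → [0,∞) by d(x,x') = inf{r ≥ 0 : x and x' lie in the same block of θ_X(r)}. Then d is a pseudo-ultrametric on X (d(x,x) = 0, d is symmetric, and d(x,x'') ≤ max(d(x,x'), d(x',x'')) for all x, x', x''), and for every r ≥ 0, two points x, x' lie in the same block of θ_X(r) if and only if d(x,x') ≤ r; consequently the blocks of θ_X(r) are exactly the equivalence classes of ∼_r for the pseudometric d, so θ_X is realized by the Vietoris–Rips hierarchical scheme applied to (X,d). -/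
/-- Every persistent set (a family `θ` of equivalence relations on a finite set `X`,
indexed by `r ∈ [0,∞)`, monotone and locally constant to the right) which eventually has
a single block is realized by the Vietoris–Rips hierarchical scheme for the
pseudo-ultrametric `d(x,x') = inf {r ≥ 0 : θ r x x'}`:  `d` satisfies `d(x,x) = 0`,
symmetry and the ultrametric inequality, two points are `θ r`-related iff `d(x,x') ≤ r`,
and hence the blocks of `θ r` are exactly the `∼_r`-classes for `d`. -/
theorem stmt_18 (X : Type) [Finite X]
    (θ : ℝ → X → X → Prop)
    (hEq : ∀ r : ℝ, 0 ≤ r → Equivalence (θ r))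
    (hMono : ∀ r s : ℝ, 0 ≤ r → r ≤ s → ∀ x x' : X, θ r x x' → θ s x x')
    (hRight : ∀ r : ℝ, 0 ≤ r → ∃ ε > (0 : ℝ), ∀ r' : ℝ, r ≤ r' → r' ≤ r + ε →
      ∀ x x' : X, (θ r' x x' ↔ θ r x x'))
    (hOne : ∃ t : ℝ, 0 ≤ t ∧ ∀ x x' : X, θ t x x')
    (d : X → X → ℝ)
    (hd : ∀ x x' : X, d x x' = sInf {r : ℝ | 0 ≤ r ∧ θ r x x'}) :
    (∀ x : X, d x x = 0) ∧
    (∀ x x' : X, d x x' = d x' x) ∧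
    (∀ x x' x'' : X, d x x'' ≤ max (d x x') (d x' x'')) ∧
    (∀ r : ℝ, 0 ≤ r → ∀ x x' : X, (θ r x x' ↔ d x x' ≤ r)) ∧
    (∀ r : ℝ, 0 ≤ r → ∀ x x' : X,
      (θ r x x' ↔ Relation.ReflTransGen (fun a b : X => d a b ≤ r) x x')) := by
  have hnonneg : ∀ x x', 0 ≤ d x x' := fun x x' => by
    rw [hd]
    exact Real.sInf_nonneg fun r hr => hr.1
  have hiff : ∀ r : ℝ, 0 ≤ r → ∀ x x' : X, (θ r x x' ↔ d x x' ≤ r) := by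
    intro r hr x x'
    have hbdd : BddBelow {s : ℝ | 0 ≤ s ∧ θ s x x'} := ⟨0, fun s hs => hs.1⟩
    refine ⟨fun h => (hd x x').trans_le (csInf_le hbdd ⟨hr, h⟩), fun h => ?_⟩
    obtain ⟨ε, hε, hconst⟩ := hRight r hr
    obtain ⟨t, ht, hone⟩ := hOne
    have hlt : sInf {s : ℝ | 0 ≤ s ∧ θ s x x'} < r + ε := by
      rw [← hd]
      linarith
    have hne : {s : ℝ | 0 ≤ s ∧ θ s x x'}.Nonempty := ⟨t, ht, hone x x'⟩
    obtain ⟨s, ⟨hs, hθ⟩, hsr⟩ := exists_lt_of_csInf_lt hne hlt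
    exact (hconst (r + ε) (by linarith) le_rfl x x').1 (hMono s _ hs hsr.le x x' hθ)
  refine ⟨fun x => le_antisymm ((hiff 0 le_rfl x x).1 ((hEq 0 le_rfl).refl x)) (hnonneg x x),
    fun x x' => ?_, fun x x' x'' => ?_, hiff, fun r hr x x' => ?_⟩
  · exact le_antisymm
      ((hiff _ (hnonneg x' x) x x').1
        ((hEq _ (hnonneg x' x)).symm ((hiff _ (hnonneg x' x) _ _).2 le_rfl)))
      ((hiff _ (hnonneg x x') x' x).1
        ((hEq _ (hnonneg x x')).symm ((hiff _ (hnonneg x x') _ _).2 le_rfl)))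
  · have hmax : 0 ≤ max (d x x') (d x' x'') := le_max_of_le_left (hnonneg x x')
    exact (hiff _ hmax x x'').1 ((hEq _ hmax).trans
      ((hiff _ hmax x x').2 (le_max_left _ _)) ((hiff _ hmax x' x'').2 (le_max_right _ _)))
  · refine ⟨fun h => .single ((hiff r hr x x').1 h), fun h => ?_⟩
    induction h with
    | refl => exact (hEq r hr).refl x
    | tail _ hbc ih => exact (hEq r hr).trans ih ((hiff r hr _ _).2 hbc)
end
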